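/- arXiv:0912.5091 — 2 statements merged into one kernel-verified Lean document; each statement's English description precedes it below -/
import Mathlib

section
/- There exists a Hadamard matrix of order 28324 = 4·7081. -/
open Finset Matrix Kronecker

/-- Nonperiodic autocorrelation `N_X(j)` of a sequence of length `m` (0-indexed):
`N_X(j) = ∑_{k=0}^{m-j-1} x_k x_{k+j}`. -/
def autocorr (m : ℕ) (X : ℕ → ℤ) (j : ℕ) : ℤ :=
  ∑ k ∈ Finset.range (m - j), X k * X (k + j)

/-- A binary (±1) sequence of length `m`. -/
def IsBinarySeq (m : ℕ) (X : ℕ → ℤ) : Prop :=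
  ∀ i < m, X i = 1 ∨ X i = -1

/-- Base sequences `BS(r,s)`: binary sequences `A, B` of length `r` and `C, D` of
length `s` whose nonperiodic autocorrelations sum to zero for all `j ≥ 1`. -/
def IsBaseSeq (r s : ℕ) (A B C D : ℕ → ℤ) : Prop :=
  IsBinarySeq r A ∧ IsBinarySeq r B ∧ IsBinarySeq s C ∧ IsBinarySeq s D ∧
    ∀ j, 1 ≤ j →
      autocorr r A j + autocorr r B j + autocorr s C j + autocorr s D j = 0

/-- A Golay pair of length `g`. -/
def IsGolayPair (g : ℕ) (A B : ℕ → ℤ) : Prop :=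
  IsBinarySeq g A ∧ IsBinarySeq g B ∧
    ∀ j, 1 ≤ j → autocorr g A j + autocorr g B j = 0

/-- Normal sequences `NS(n)`: base sequences in `BS(n+1,n)` whose first two
sequences agree in the first `n` entries. -/
def IsNormalSeq (n : ℕ) (A B C D : ℕ → ℤ) : Prop :=
  IsBaseSeq (n + 1) n A B C D ∧ ∀ i < n, B i = A i

/-- Near-normal sequences `NN(n)`: base sequences in `BS(n+1,n)` with
`b_i = (-1)^(i-1) a_i` for `i = 1, …, n` (0-indexed: `B i = (-1)^i * A i`). -/
def IsNearNormalSeq (n : ℕ) (A B C D : ℕ → ℤ) : Prop :=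
  IsBaseSeq (n + 1) n A B C D ∧ ∀ i < n, B i = (-1) ^ i * A i

/-- T-sequences of length `t`: four `{-1,0,1}`-sequences such that at every
position exactly one of them is nonzero, and the sum of their nonperiodic
autocorrelations vanishes for all `j ≥ 1`. -/
def IsTSeq (t : ℕ) (T₁ T₂ T₃ T₄ : ℕ → ℤ) : Prop :=
  (∀ i < t, T₁ i ∈ ({-1, 0, 1} : Set ℤ)) ∧
  (∀ i < t, T₂ i ∈ ({-1, 0, 1} : Set ℤ)) ∧
  (∀ i < t, T₃ i ∈ ({-1, 0, 1} : Set ℤ)) ∧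
  (∀ i < t, T₄ i ∈ ({-1, 0, 1} : Set ℤ)) ∧
  (∀ i < t,
    (T₁ i ≠ 0 ∧ T₂ i = 0 ∧ T₃ i = 0 ∧ T₄ i = 0) ∨
    (T₁ i = 0 ∧ T₂ i ≠ 0 ∧ T₃ i = 0 ∧ T₄ i = 0) ∨
    (T₁ i = 0 ∧ T₂ i = 0 ∧ T₃ i ≠ 0 ∧ T₄ i = 0) ∨
    (T₁ i = 0 ∧ T₂ i = 0 ∧ T₃ i = 0 ∧ T₄ i ≠ 0)) ∧
  ∀ j, 1 ≤ j →
    autocorr t T₁ j + autocorr t T₂ j + autocorr t T₃ j + autocorr t T₄ j = 0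

/-- An orthogonal design `OD(4d; d,d,d,d)`: four `4d × 4d` matrices with entries
in `{-1,0,1}`, pairwise disjoint supports covering every position, with
`Aᵢ Aᵢᵀ = d·I` and `Aᵢ Aⱼᵀ + Aⱼ Aᵢᵀ = 0` for `i ≠ j`. -/
def IsOD (d : ℕ) (A : Fin 4 → Matrix (Fin (4 * d)) (Fin (4 * d)) ℤ) : Prop :=
  (∀ k i j, A k i j ∈ ({-1, 0, 1} : Set ℤ)) ∧
  (∀ i j, ∃! k : Fin 4, A k i j ≠ 0) ∧
  (∀ k, A k * (A k)ᵀ = (d : ℤ) • 1) ∧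
  (∀ k l, k ≠ l → A k * (A l)ᵀ + A l * (A k)ᵀ = 0)

/-- Williamson-type matrices of order `w`: four pairwise amicable `±1` matrices
with `∑ Wᵢ Wᵢᵀ = 4w·I`. -/
def IsWilliamsonType (w : ℕ) (W : Fin 4 → Matrix (Fin w) (Fin w) ℤ) : Prop :=
  (∀ k i j, W k i j = 1 ∨ W k i j = -1) ∧
  (∀ k l, W k * (W l)ᵀ = W l * (W k)ᵀ) ∧
  (∑ k, W k * (W k)ᵀ) = ((4 * w : ℕ) : ℤ) • 1

/-- A Hadamard matrix: a `±1` matrix `H` with `H Hᵀ = m·I`, where `m` is the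
size of the (finite) index type. -/
def IsHadamardMatrix {n : Type*} [Fintype n] [DecidableEq n] (H : Matrix n n ℤ) : Prop :=
  (∀ i j, H i j = 1 ∨ H i j = -1) ∧ H * Hᵀ = (Fintype.card n : ℤ) • 1

section GoethalsSeidel

variable {G : Type*} [AddCommGroup G]

/-- The permutation matrix of the negation map of `G`. -/
def reversal (G : Type*) [AddCommGroup G] [DecidableEq G] : Matrix G G ℤ :=
  Matrix.of fun i j => if i + j = 0 then 1 else 0

variable [DecidableEq G]

lemma reversal_transpose : (reversal G)ᵀ = reversal G := by
  ext i j
  simp [reversal, add_comm]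

variable [Fintype G]

lemma mul_reversal_apply (A : Matrix G G ℤ) (i j : G) : (A * reversal G) i j = A i (-j) := by
  simp [reversal, Matrix.mul_apply, add_eq_zero_iff_eq_neg]

lemma reversal_mul_apply (A : Matrix G G ℤ) (i j : G) : (reversal G * A) i j = A (-i) j := by
  simp [reversal, Matrix.mul_apply, add_eq_zero_iff_neg_eq]

lemma reversal_mul_reversal : reversal G * reversal G = 1 := by
  ext i j
  rw [mul_reversal_apply]
  simp [reversal, Matrix.one_apply, add_neg_eq_zero]

lemma reversal_mul_circulant (a : G → ℤ) :
    reversal G * circulant a = circulant (fun i => a (-i)) * reversal G := by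
  ext i j
  simp [mul_reversal_apply, reversal_mul_apply, circulant_apply, sub_eq_add_neg, add_comm]

/-- The Goethals–Seidel array of four circulant matrices, as a block matrix. -/
def goethalsSeidel (a b c d : G → ℤ) : Matrix (Fin 4) (Fin 4) (Matrix G G ℤ)
  | 0, 0 => circulant a
  | 0, 1 => circulant b * reversal G
  | 0, 2 => circulant c * reversal G
  | 0, 3 => circulant d * reversal G
  | 1, 0 => -(circulant b * reversal G)
  | 1, 1 => circulant a
  | 1, 2 => (circulant d)ᵀ * reversal G
  | 1, 3 => -((circulant c)ᵀ * reversal G)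
  | 2, 0 => -(circulant c * reversal G)
  | 2, 1 => -((circulant d)ᵀ * reversal G)
  | 2, 2 => circulant a
  | 2, 3 => (circulant b)ᵀ * reversal G
  | 3, 0 => -(circulant d * reversal G)
  | 3, 1 => (circulant c)ᵀ * reversal G
  | 3, 2 => -((circulant b)ᵀ * reversal G)
  | 3, 3 => circulant a

lemma goethalsSeidel_mul_transpose (a b c d : G → ℤ) (m : ℤ)
    (h : circulant a * (circulant a)ᵀ + circulant b * (circulant b)ᵀ
      + circulant c * (circulant c)ᵀ + circulant d * (circulant d)ᵀ = m • 1) :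
    goethalsSeidel a b c d * (goethalsSeidel a b c d)ᵀ.map Matrix.transpose = m • 1 := by
  have hR (X : Matrix G G ℤ) : X * reversal G * reversal G = X := by
    rw [Matrix.mul_assoc, reversal_mul_reversal, Matrix.mul_one]
  have key (x : G → ℤ) : ∃ y, (circulant x)ᵀ = circulant y ∧
      (∀ X : Matrix G G ℤ, X * reversal G * circulant x = X * circulant y * reversal G) ∧
      ∀ X : Matrix G G ℤ, X * reversal G * circulant y = X * circulant x * reversal G := by
    refine ⟨fun i => x (-i), transpose_circulant x, fun X => ?_, fun X => ?_⟩ <;>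
      simp only [Matrix.mul_assoc, reversal_mul_circulant, neg_neg]
  obtain ⟨a', ha, -, ha₂⟩ := key a
  obtain ⟨b', hb, hb₁, hb₂⟩ := key b
  obtain ⟨c', hc, hc₁, hc₂⟩ := key c
  obtain ⟨d', hd, hd₁, hd₂⟩ := key d
  have hb' : (circulant b')ᵀ = circulant b := by rw [← hb, Matrix.transpose_transpose]
  have hc' : (circulant c')ᵀ = circulant c := by rw [← hc, Matrix.transpose_transpose]
  have hd' : (circulant d')ᵀ = circulant d := by rw [← hd, Matrix.transpose_transpose]
  have hx (x y : G → ℤ) (hxy : (circulant x)ᵀ = circulant y) :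
      reversal G * circulant y = circulant x * reversal G := by
    rw [← hxy, transpose_circulant, reversal_mul_circulant]
    simp only [neg_neg]
  rw [ha, hb, hc, hd] at h
  ext1 i j
  rw [Matrix.mul_apply, Fin.sum_univ_four, Matrix.smul_apply, Matrix.one_apply]
  simp only [Matrix.map_apply, Matrix.transpose_apply]
  fin_cases i <;> fin_cases j <;>
    dsimp only [goethalsSeidel] <;>
    simp only [Fin.reduceFinMk, Fin.zero_eta, Fin.mk_one, Fin.reduceEq, zero_ne_one, one_ne_zero,
      if_true, if_false, smul_zero, Matrix.transpose_mul, Matrix.transpose_neg, Matrix.neg_mul,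
      Matrix.mul_neg, neg_neg, reversal_transpose, ha, hb, hc, hd, hb', hc', hd',
      hx _ _ hb, hx _ _ hc, hx _ _ hd, hx _ _ hb', hx _ _ hc', hx _ _ hd', ← Matrix.mul_assoc,
      ha₂, hb₁, hc₁, hd₁, hb₂, hc₂, hd₂, hR, ← h] <;>
    simp only [circulant_mul_comm] <;>
    abel

theorem exists_isHadamardMatrix_of_circulant (a b c d : G → ℤ)
    (ha : ∀ g, a g = 1 ∨ a g = -1) (hb : ∀ g, b g = 1 ∨ b g = -1)
    (hc : ∀ g, c g = 1 ∨ c g = -1) (hd : ∀ g, d g = 1 ∨ d g = -1)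
    (h : circulant a * (circulant a)ᵀ + circulant b * (circulant b)ᵀ
      + circulant c * (circulant c)ᵀ + circulant d * (circulant d)ᵀ
        = ((4 * Fintype.card G : ℕ) : ℤ) • 1) :
    ∃ H : Matrix (Fin 4 × G) (Fin 4 × G) ℤ, IsHadamardMatrix H := by
  refine ⟨Matrix.comp _ _ _ _ _ (goethalsSeidel a b c d), ?_, ?_⟩
  · rintro ⟨i, g⟩ ⟨j, k⟩
    rw [Matrix.comp_apply]
    fin_cases i <;> fin_cases j <;> dsimp only [goethalsSeidel] <;>
      simp only [Matrix.neg_apply, mul_reversal_apply, Matrix.transpose_apply, circulant_apply,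
        neg_eq_iff_eq_neg, neg_neg] <;>
      first
      | apply ha | apply hb | apply hc | apply hd
      | exact (hb _).symm | exact (hc _).symm | exact (hd _).symm
  · have hT : (Matrix.comp _ _ _ _ _ (goethalsSeidel a b c d))ᵀ
        = Matrix.comp _ _ _ _ _ ((goethalsSeidel a b c d)ᵀ.map Matrix.transpose) := rfl
    have hmul := map_mul (Matrix.compRingEquiv (Fin 4) G ℤ) (goethalsSeidel a b c d)
      ((goethalsSeidel a b c d)ᵀ.map Matrix.transpose)
    rw [goethalsSeidel_mul_transpose a b c d _ h, map_zsmul, map_one] at hmul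
    rw [hT, Fintype.card_prod, Fintype.card_fin]
    exact hmul.symm

end GoethalsSeidel

theorem IsHadamardMatrix.reindex {m n : Type*} [Fintype m] [DecidableEq m] [Fintype n]
    [DecidableEq n] (e : m ≃ n) {H : Matrix m m ℤ} (hH : IsHadamardMatrix H) :
    IsHadamardMatrix (Matrix.reindex e e H) := by
  refine ⟨fun i j => hH.1 _ _, ?_⟩
  rw [Matrix.reindex_apply, Matrix.transpose_submatrix, Matrix.submatrix_mul_equiv, hH.2,
    Fintype.card_congr e]
  simp only [Matrix.submatrix_smul, Pi.smul_apply, Matrix.submatrix_one_equiv]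

section CooperWallis

lemma kronecker_neg {l m n p : Type*} (A : Matrix l m ℤ) (B : Matrix n p ℤ) :
    A ⊗ₖ (-B) = -(A ⊗ₖ B) := by
  ext i j
  simp

variable {K L : Type*}

/-- The function `∑ i, x i ⊗ w i` on `K × L`. -/
def tensorSum (x : Fin 4 → K → ℤ) (w : Fin 4 → L → ℤ) (g : K × L) : ℤ :=
  ∑ i, x i g.1 * w i g.2

lemma tensorSum_eq_one_or {x : Fin 4 → K → ℤ} {w : Fin 4 → L → ℤ}
    (hx : ∀ g, ∃ i, (x i g = 1 ∨ x i g = -1) ∧ ∀ j, j ≠ i → x j g = 0)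
    (hw : ∀ i g, w i g = 1 ∨ w i g = -1) (g : K × L) :
    tensorSum x w g = 1 ∨ tensorSum x w g = -1 := by
  obtain ⟨i, hi, hj⟩ := hx g.1
  rw [tensorSum, Finset.sum_eq_single i (fun j _ hji => by rw [hj j hji, zero_mul])
    (fun h => absurd (Finset.mem_univ i) h)]
  rcases hi with hi | hi <;> rcases hw i g.2 with h | h <;> simp [hi, h]

variable [AddCommGroup K] [AddCommGroup L]

lemma circulant_tensorSum (x : Fin 4 → K → ℤ) (a b c d : L → ℤ) :
    circulant (tensorSum x ![a, b, c, d]) = circulant (x 0) ⊗ₖ circulant a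
      + circulant (x 1) ⊗ₖ circulant b + circulant (x 2) ⊗ₖ circulant c
      + circulant (x 3) ⊗ₖ circulant d := by
  ext i j
  simp only [circulant_apply, tensorSum, Fin.sum_univ_four, Matrix.add_apply,
    Matrix.kroneckerMap_apply]
  rfl

variable [Fintype K] [DecidableEq K] [Fintype L] [DecidableEq L]

/-- The Cooper–Wallis construction: T-matrices of order `|K|` and Williamson matrices of order
`|L|` give a Hadamard matrix of order `4 |K| |L|`. -/
theorem exists_isHadamardMatrix_of_tMatrices (x : Fin 4 → K → ℤ) (w : Fin 4 → L → ℤ)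
    (hx : ∀ g, ∃ i, (x i g = 1 ∨ x i g = -1) ∧ ∀ j, j ≠ i → x j g = 0)
    (hxx : ∑ i, circulant (x i) * (circulant (x i))ᵀ = (Fintype.card K : ℤ) • 1)
    (hw : ∀ i g, w i g = 1 ∨ w i g = -1) (hsymm : ∀ i g, w i (-g) = w i g)
    (hww : ∑ i, circulant (w i) * (circulant (w i))ᵀ = ((4 * Fintype.card L : ℕ) : ℤ) • 1) :
    ∃ H : Matrix (Fin 4 × K × L) (Fin 4 × K × L) ℤ, IsHadamardMatrix H := by
  have hneg (i : Fin 4) (g : L) : -w i g = 1 ∨ -w i g = -1 := by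
    rcases hw i g with h | h <;> simp [h]
  have hT (i : Fin 4) : (circulant (w i))ᵀ = circulant (w i) := by
    rw [transpose_circulant]
    congr 1
    funext g
    exact hsymm i g
  have hN (i : Fin 4) : circulant (fun g => -w i g) = -circulant (w i) := circulant_neg _
  refine exists_isHadamardMatrix_of_circulant
    (tensorSum x ![w 0, w 1, w 2, w 3])
    (tensorSum x ![fun g => -w 1 g, w 0, w 3, fun g => -w 2 g])
    (tensorSum x ![fun g => -w 2 g, fun g => -w 3 g, w 0, w 1])
    (tensorSum x ![fun g => -w 3 g, w 2, fun g => -w 1 g, w 0])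
    (tensorSum_eq_one_or hx ?_) (tensorSum_eq_one_or hx ?_) (tensorSum_eq_one_or hx ?_)
    (tensorSum_eq_one_or hx ?_) ?_
  iterate 4
    · simp only [Fin.forall_fin_succ, Fin.forall_fin_zero]
      exact ⟨by first | exact hw _ | exact hneg _, by first | exact hw _ | exact hneg _,
        by first | exact hw _ | exact hneg _, by first | exact hw _ | exact hneg _, trivial⟩
  · have hprod : (∑ i, circulant (x i) * (circulant (x i))ᵀ)
        ⊗ₖ (∑ i, circulant (w i) * (circulant (w i))ᵀ)
        = ((4 * Fintype.card (K × L) : ℕ) : ℤ) • (1 : Matrix (K × L) (K × L) ℤ) := by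
      rw [hxx, hww, Matrix.smul_kronecker, Matrix.kronecker_smul, Matrix.one_kronecker_one,
        smul_smul, Fintype.card_prod]
      push_cast
      ring_nf
    rw [← hprod]
    simp only [circulant_tensorSum, Fin.sum_univ_four, Matrix.transpose_add, hN,
      kronecker_neg, Matrix.transpose_neg, ← Matrix.kroneckerMap_transpose, hT, Matrix.add_mul,
      Matrix.mul_add, Matrix.neg_mul, Matrix.mul_neg,
      ← Matrix.mul_kronecker_mul, Matrix.add_kronecker, Matrix.kronecker_add]
    simp only [circulant_mul_comm (w 1) (w 0), circulant_mul_comm (w 2) (w 0),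
      circulant_mul_comm (w 3) (w 0), circulant_mul_comm (w 2) (w 1),
      circulant_mul_comm (w 3) (w 1), circulant_mul_comm (w 3) (w 2)]
    abel

end CooperWallis

lemma sum_circulant_mul_transpose {G ι : Type*} [AddCommGroup G] [Fintype G] [DecidableEq G]
    [Fintype ι] (x : ι → G → ℤ) (m : ℤ)
    (h : ∀ s, ∑ k, ∑ i, x i (s + k) * x i k = if s = 0 then m else 0) :
    ∑ i, circulant (x i) * (circulant (x i))ᵀ = m • 1 := by
  ext p q
  simp only [Matrix.sum_apply, Matrix.mul_apply, Matrix.transpose_apply, circulant_apply]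
  rw [Finset.sum_comm, Matrix.smul_apply, Matrix.one_apply, smul_eq_mul, mul_ite, mul_one,
    mul_zero]
  have hpq := h (p - q)
  simp only [sub_eq_zero] at hpq
  rw [← hpq, ← Equiv.sum_comp (Equiv.subLeft q)]
  refine Finset.sum_congr rfl fun k _ => Finset.sum_congr rfl fun i _ => ?_
  rw [Equiv.subLeft_apply, sub_sub_cancel, ← sub_add]

lemma ZMod.sum_val_add {n : ℕ} [NeZero n] (F : ℕ → ℕ → ℤ) (s : ZMod n) :
    ∑ k : ZMod n, F (s + k).val k.val = ∑ k ∈ Finset.range n, F ((s.val + k) % n) k := by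
  simp only [ZMod.val_add]
  refine Finset.sum_bij (fun k _ => k.val) (fun k _ => Finset.mem_range.2 k.val_lt)
    (fun k _ l _ h => ZMod.val_injective n h) (fun m hm => ?_) (fun k _ => rfl)
  exact ⟨m, Finset.mem_univ _, ZMod.val_cast_of_lt (Finset.mem_range.1 hm)⟩

/-- The sign of the `k`-th binary digit of `N`: `-1` if the digit is `1`, and `1` otherwise. -/
def bitSign (N k : ℕ) : ℤ :=
  bif N.testBit k then -1 else 1

lemma bitSign_eq_one_or (N k : ℕ) : bitSign N k = 1 ∨ bitSign N k = -1 := by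
  unfold bitSign
  cases N.testBit k <;> simp

lemma bitSign_mul_bitSign (N u v : ℕ) :
    bitSign N u * bitSign N v = bif N.testBit u == N.testBit v then 1 else -1 := by
  unfold bitSign
  cases N.testBit u <;> cases N.testBit v <;> rfl

/-- The first binary digits of the indices (from `0` to `3`) of the T-matrices of order `73` that
are nonzero at the positions `0` to `72`. -/
def tIndexLow : ℕ := 21942967883805557094

/-- The second binary digits of the indices whose first digits `tIndexLow` holds. -/
def tIndexHigh : ℕ := 8326876006005035324206

/-- The binary digits of `tSign` give the signs of the entries of the T-matrices. -/
def tSign : ℕ := 7795154729592934608524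

/-- The index of the T-matrix of order `73` that is nonzero at a given position. -/
def tIndex (k : ℕ) : Fin 4 :=
  bif tIndexLow.testBit k then
    bif tIndexHigh.testBit k then 3 else 1
  else
    bif tIndexHigh.testBit k then 2 else 0

/-- First rows of four circulant T-matrices of order `73`, constant up to sign on the cosets of
the multiplicative subgroup `{1, 8, 64}`. -/
def tRow (i : Fin 4) (k : ZMod 73) : ℤ :=
  if tIndex k.val = i then bitSign tSign k.val else 0

lemma sum_tRow_mul_tRow (k l : ZMod 73) :
    ∑ i, tRow i k * tRow i l =
      bif tIndexLow.testBit k.val == tIndexLow.testBit l.val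
          && tIndexHigh.testBit k.val == tIndexHigh.testBit l.val then
        bif tSign.testBit k.val == tSign.testBit l.val then 1 else -1
      else 0 := by
  rw [← bitSign_mul_bitSign]
  cases hk : tIndexLow.testBit k.val <;> cases hl : tIndexLow.testBit l.val <;>
    cases hk' : tIndexHigh.testBit k.val <;> cases hl' : tIndexHigh.testBit l.val <;>
    simp [tRow, tIndex, hk, hl, hk', hl']

lemma tRow_autocorrelation (s : ZMod 73) :
    ∑ k, ∑ i, tRow i (s + k) * tRow i k = if s = 0 then 73 else 0 := by
  simp only [sum_tRow_mul_tRow]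
  rw [ZMod.sum_val_add (fun u v =>
      bif tIndexLow.testBit u == tIndexLow.testBit v
          && tIndexHigh.testBit u == tIndexHigh.testBit v then
        bif tSign.testBit u == tSign.testBit v then 1 else -1
      else 0) s]
  simp only [← ZMod.val_eq_zero s]
  have hs := s.val_lt
  generalize s.val = t at hs ⊢
  revert t
  decide +kernel

/-- The binary digits `1` of `williamsonBits i` are the positions of the entries `-1` in the first
row of the `i`-th of four symmetric circulant Williamson matrices of order `97`, obtained from the
Paley conference matrix of order `194`. -/
def williamsonBits : Fin 4 → ℕ
  | 0 => 18927100996802604420171846384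
  | 1 => 18927100996802604420171846385
  | 2 => 83640916393882867108861249987
  | 3 => 83640916393882867108861249987

/-- First rows of four circulant Williamson matrices of order `97`. -/
def williamsonRow (i : Fin 4) (k : ZMod 97) : ℤ :=
  bitSign (williamsonBits i) k.val

lemma bits_autocorrelation :
    ∀ t < 97, ∑ k ∈ Finset.range 97,
      ((bif (williamsonBits 0).testBit ((t + k) % 97) == (williamsonBits 0).testBit k
          then (1 : ℤ) else -1)
        + (bif (williamsonBits 1).testBit ((t + k) % 97) == (williamsonBits 1).testBit k
          then (1 : ℤ) else -1)
        + (bif (williamsonBits 2).testBit ((t + k) % 97) == (williamsonBits 2).testBit k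
          then (1 : ℤ) else -1)
        + (bif (williamsonBits 3).testBit ((t + k) % 97) == (williamsonBits 3).testBit k
          then (1 : ℤ) else -1)) = if t = 0 then 388 else 0 := by
  decide +kernel

lemma williamsonRow_autocorrelation (s : ZMod 97) :
    ∑ k, ∑ i, williamsonRow i (s + k) * williamsonRow i k = if s = 0 then 388 else 0 := by
  simp only [williamsonRow, bitSign_mul_bitSign, Fin.sum_univ_four]
  rw [ZMod.sum_val_add (fun u v =>
      (bif (williamsonBits 0).testBit u == (williamsonBits 0).testBit v then (1 : ℤ) else -1)
        + (bif (williamsonBits 1).testBit u == (williamsonBits 1).testBit v then (1 : ℤ) else -1)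
        + (bif (williamsonBits 2).testBit u == (williamsonBits 2).testBit v then (1 : ℤ) else -1)
        + (bif (williamsonBits 3).testBit u == (williamsonBits 3).testBit v then (1 : ℤ) else -1))
      s]
  simp only [← ZMod.val_eq_zero s]
  exact bits_autocorrelation s.val s.val_lt

lemma williamsonRow_neg (i : Fin 4) (k : ZMod 97) :
    williamsonRow i (-k) = williamsonRow i k := by
  revert i k
  decide +kernel

/-- There exists a Hadamard matrix of order `28324 = 4 · 7081`. -/
theorem hadamard_28324 :
    ∃ H : Matrix (Fin (4 * 7081)) (Fin (4 * 7081)) ℤ, IsHadamardMatrix H := by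
  obtain ⟨H, hH⟩ := exists_isHadamardMatrix_of_tMatrices tRow williamsonRow
    (fun g => ⟨tIndex g.val, by simpa [tRow] using bitSign_eq_one_or _ _,
      fun j hj => if_neg (Ne.symm hj)⟩)
    (sum_circulant_mul_transpose _ _ (by simpa [ZMod.card] using tRow_autocorrelation))
    (fun i g => bitSign_eq_one_or _ _) williamsonRow_neg
    (sum_circulant_mul_transpose _ _ (by simpa [ZMod.card] using williamsonRow_autocorrelation))
  have e : Fin 4 × ZMod 73 × ZMod 97 ≃ Fin (4 * 7081) :=
    Fintype.equivFinOfCardEq (by simp [ZMod.card])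
  exact ⟨_, hH.reindex e⟩
end

section
/- For every even integer n with 2 ≤ n ≤ 40, near-normal sequences NN(n) exist (i.e., the Yang conjecture on near-normal sequences holds for all even n ≤ 40). -/
open Finset Matrix Kronecker

/-- The `±1` sequence whose `i`-th term is `1` exactly when the `i`-th binary digit of `b` is `1`. -/
def signSeq (b i : ℕ) : ℤ := if b.testBit i then 1 else -1

/-- The companion of `X` in a near-normal quadruple: the alternating twist of `X` on the first
`n` terms, and `-X n` at position `n`. -/
def twist (n : ℕ) (X : ℕ → ℤ) (i : ℕ) : ℤ := if i = n then -X n else (-1) ^ i * X i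

lemma isBinarySeq_signSeq (m b : ℕ) : IsBinarySeq m (signSeq b) := by
  intro i _
  unfold signSeq
  split <;> simp

lemma IsBinarySeq.twist {n : ℕ} {X : ℕ → ℤ} (hX : IsBinarySeq (n + 1) X) :
    IsBinarySeq (n + 1) (twist n X) := by
  intro i hi
  unfold _root_.twist
  split
  · rcases hX n n.lt_succ_self with h | h <;> simp [h]
  · rcases neg_one_pow_eq_or ℤ i with h | h <;> rcases hX i hi with h' | h' <;> simp [h, h']

lemma autocorr_eq_zero_of_le {m j : ℕ} (h : m ≤ j) (X : ℕ → ℤ) : autocorr m X j = 0 := by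
  simp [autocorr, Nat.sub_eq_zero_of_le h]

/-- Only the lags `1, …, n` need to be checked to recognise a near-normal quadruple. -/
lemma exists_isNearNormalSeq {n : ℕ} (a c d : ℕ)
    (h : ∀ j < n, autocorr (n + 1) (signSeq a) (j + 1) +
      autocorr (n + 1) (twist n (signSeq a)) (j + 1) +
      autocorr n (signSeq c) (j + 1) + autocorr n (signSeq d) (j + 1) = 0) :
    ∃ A B C D : ℕ → ℤ, IsNearNormalSeq n A B C D := by
  refine ⟨signSeq a, twist n (signSeq a), signSeq c, signSeq d,
    ⟨isBinarySeq_signSeq _ _, (isBinarySeq_signSeq _ _).twist, isBinarySeq_signSeq _ _,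
      isBinarySeq_signSeq _ _, fun j hj ↦ ?_⟩, fun i hi ↦ if_neg hi.ne⟩
  obtain ⟨k, rfl⟩ := Nat.exists_eq_add_of_le' hj
  rcases lt_or_ge k n with hk | hk
  · exact h k hk
  · simp [autocorr_eq_zero_of_le (show n + 1 ≤ k + 1 by omega),
      autocorr_eq_zero_of_le (show n ≤ k + 1 by omega)]

/-- For every even integer `n` with `2 ≤ n ≤ 40`, near-normal
sequences `NN(n)` exist (Yang conjecture verified up to `40`). -/
theorem yang_conjecture_up_to_40 (n : ℕ) (hn : Even n) (h2 : 2 ≤ n)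
    (h40 : n ≤ 40) :
    ∃ A B C D : ℕ → ℤ, IsNearNormalSeq n A B C D := by
  obtain ⟨m, rfl⟩ := hn
  obtain ⟨h1, h20⟩ : 1 ≤ m ∧ m ≤ 20 := by omega
  interval_cases m
  · exact exists_isNearNormalSeq 7 1 1 (by decide +kernel)
  · exact exists_isNearNormalSeq 23 7 7 (by decide +kernel)
  · exact exists_isNearNormalSeq 117 51 45 (by decide +kernel)
  · exact exists_isNearNormalSeq 344 159 221 (by decide +kernel)
  · exact exists_isNearNormalSeq 1308 695 769 (by decide +kernel)
  · exact exists_isNearNormalSeq 7961 2751 3113 (by decide +kernel)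
  · exact exists_isNearNormalSeq 32589 10391 9059 (by decide +kernel)
  · exact exists_isNearNormalSeq 116041 39671 46915 (by decide +kernel)
  · exact exists_isNearNormalSeq 373012 206931 194685 (by decide +kernel)
  · exact exists_isNearNormalSeq 1965145 692807 589091 (by decide +kernel)
  · exact exists_isNearNormalSeq 5580028 2322047 2765019 (by decide +kernel)
  · exact exists_isNearNormalSeq 32951685 13878655 11132193 (by decide +kernel)
  · exact exists_isNearNormalSeq 132634793 40953207 42164811 (by decide +kernel)
  · exact exists_isNearNormalSeq 388243924 210660319 144831645 (by decide +kernel)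
  · exact exists_isNearNormalSeq 1399327388 707258279 592237059 (by decide +kernel)
  · exact exists_isNearNormalSeq 7912528868 3331894367 3383558319 (by decide +kernel)
  · exact exists_isNearNormalSeq 31093398017 15488219327 9888624913 (by decide +kernel)
  · exact exists_isNearNormalSeq 91015142136 40644032991 56924954397 (by decide +kernel)
  · exact exists_isNearNormalSeq 374395766332 210987634099 169762647017 (by decide +kernel)
  · exact exists_isNearNormalSeq 2088727192956 839889681195 856702264331 (by decide +kernel)
end
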